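/- Let N ∈ ℕ and 0 < ε < 1/e. If γ₁ and γ₂ are queenons with d(γ₁, γ₂) < ε, then |H_q^N(γ₁) − H_q^N(γ₂)| ≤ 8N²ε log(N/(2ε²)). -/

import Mathlib

open MeasureTheory Filter Topology
open scoped ENNReal

noncomputable section

/-- The square `[-1/2,1/2]²`. -/
def unitSq : Set (ℝ × ℝ) :=
  Set.Icc (-(1:ℝ)/2) (1/2) ×ˢ Set.Icc (-(1:ℝ)/2) (1/2)

/-- The square `σ_{i,j}^N` (for `i, j ∈ [N]`). -/
def gridSq (N i j : ℕ) : Set (ℝ × ℝ) :=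
  Set.Icc (-(1:ℝ)/2 + ((i:ℝ) - 1)/N) (-(1:ℝ)/2 + (i:ℝ)/N) ×ˢ
    Set.Icc (-(1:ℝ)/2 + ((j:ℝ) - 1)/N) (-(1:ℝ)/2 + (j:ℝ)/N)

/-- The cell of the partition `I_N` with index `i, j ∈ [2N]`. -/
def INcell (N i j : ℕ) : Set (ℝ × ℝ) :=
  {p ∈ unitSq | (-1 + ((i:ℝ) - 1)/N ≤ p.1 + p.2 ∧ p.1 + p.2 ≤ -1 + (i:ℝ)/N) ∧
    (-1 + ((j:ℝ) - 1)/N ≤ p.2 - p.1 ∧ p.2 - p.1 ≤ -1 + (j:ℝ)/N)}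

/-- The interval of the partition `J_N` of `[-1,1]` with index `i ∈ [2N]`. -/
def JNcell (N i : ℕ) : Set ℝ :=
  Set.Icc (-1 + ((i:ℝ) - 1)/N) (-1 + (i:ℝ)/N)

/-- A member of the family `R` of subsets of the square. -/
def Rset (a₁ b₁ a₂ b₂ : ℝ) : Set (ℝ × ℝ) :=
  {p ∈ unitSq | (a₁ ≤ p.1 + p.2 ∧ p.1 + p.2 ≤ b₁) ∧ (a₂ ≤ p.2 - p.1 ∧ p.2 - p.1 ≤ b₂)}

/-- The distance `d` between two Borel measures on the square: the supremum of
`|γ₁(α) − γ₂(α)|` over `α ∈ R`. -/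
def qdist (μ ν : Measure (ℝ × ℝ)) : ℝ :=
  sSup {t : ℝ | ∃ a₁ b₁ a₂ b₂ : ℝ, a₁ ∈ Set.Icc (-1:ℝ) 1 ∧ b₁ ∈ Set.Icc (-1:ℝ) 1 ∧
    a₂ ∈ Set.Icc (-1:ℝ) 1 ∧ b₂ ∈ Set.Icc (-1:ℝ) 1 ∧
    t = |(μ (Rset a₁ b₁ a₂ b₂)).toReal - (ν (Rset a₁ b₁ a₂ b₂)).toReal|}

/-- A permuton: a Borel probability measure on the square with uniform marginals. -/
def IsPermuton (μ : Measure (ℝ × ℝ)) : Prop :=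
  IsProbabilityMeasure μ ∧ μ unitSqᶜ = 0 ∧
  ∀ a b : ℝ, -(1:ℝ)/2 ≤ a → a ≤ b → b ≤ 1/2 →
    μ (Set.Icc a b ×ˢ Set.Icc (-(1:ℝ)/2) (1/2)) = ENNReal.ofReal (b - a) ∧
    μ (Set.Icc (-(1:ℝ)/2) (1/2) ×ˢ Set.Icc a b) = ENNReal.ofReal (b - a)

/-- An `N`-step permuton: a permuton with constant density on each square `σ_{i,j}^N`. -/
def IsStepPermutonN (N : ℕ) (μ : Measure (ℝ × ℝ)) : Prop :=
  IsPermuton μ ∧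
  ∀ i ∈ Finset.Icc 1 N, ∀ j ∈ Finset.Icc 1 N, ∃ c : ℝ≥0∞,
    ∀ s : Set (ℝ × ℝ), s ⊆ gridSq N i j → MeasurableSet s → μ s = c * volume s

/-- A step permuton. -/
def IsStepPermuton (μ : Measure (ℝ × ℝ)) : Prop :=
  ∃ N : ℕ, 0 < N ∧ IsStepPermutonN N μ

/-- Sub-uniform diagonal marginals. -/
def SubUniformDiag (μ : Measure (ℝ × ℝ)) : Prop :=
  ∀ a b : ℝ, -1 ≤ a → a ≤ b → b ≤ 1 →
    μ {p ∈ unitSq | a ≤ p.1 + p.2 ∧ p.1 + p.2 ≤ b} ≤ ENNReal.ofReal (b - a) ∧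
    μ {p ∈ unitSq | a ≤ p.2 - p.1 ∧ p.2 - p.1 ≤ b} ≤ ENNReal.ofReal (b - a)

/-- The set `Γ` of queenons: the closure, in the topology of weak convergence of Borel
probability measures, of the set of step permutons with sub-uniform diagonal marginals. -/
def queenons : Set (ProbabilityMeasure (ℝ × ℝ)) :=
  closure {μ : ProbabilityMeasure (ℝ × ℝ) |
    IsStepPermuton μ.toMeasure ∧ SubUniformDiag μ.toMeasure}

/-- The pushforward `γ⁺` of `γ` under `(x,y) ↦ x+y`. -/
def diagPlus (γ : Measure (ℝ × ℝ)) : Measure ℝ := γ.map fun p => p.1 + p.2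

/-- The pushforward `γ⁻` of `γ` under `(x,y) ↦ y−x`. -/
def diagMinus (γ : Measure (ℝ × ℝ)) : Measure ℝ := γ.map fun p => p.2 - p.1

/-- The measure `γ̄⁺` on `[-1,1]`, with `γ̄⁺([a,b]) = (b−a) − γ⁺([a,b])`. -/
def barPlus (γ : Measure (ℝ × ℝ)) : Measure ℝ :=
  volume.restrict (Set.Icc (-1:ℝ) 1) - diagPlus γ

/-- The measure `γ̄⁻` on `[-1,1]`, with `γ̄⁻([a,b]) = (b−a) − γ⁻([a,b])`. -/
def barMinus (γ : Measure (ℝ × ℝ)) : Measure ℝ :=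
  volume.restrict (Set.Icc (-1:ℝ) 1) - diagMinus γ

/-- The uniform probability measure on `[-1,1]` (density `1/2`). -/
def unif11 : Measure ℝ := (2 : ℝ≥0∞)⁻¹ • volume.restrict (Set.Icc (-1:ℝ) 1)

open Classical in
/-- The Kullback–Leibler divergence of `μ` with respect to `ν`, as an extended real:
`∫ log (dμ/dν) dμ` if `μ ≪ ν` and the integrand is integrable, and `+∞` otherwise. -/
def DKL {X : Type*} [MeasurableSpace X] (μ ν : Measure X) : EReal :=
  if μ ≪ ν ∧ Integrable (fun x => Real.log (μ.rnDeriv ν x).toReal) μ then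
    ((∫ x, Real.log (μ.rnDeriv ν x).toReal ∂μ : ℝ) : EReal)
  else ⊤

/-- The Q-entropy `H_q(γ) = −D_KL(γ) − D_KL(γ̄⁺) − D_KL(γ̄⁻) + 2 log 2 − 3`. -/
def Hq (γ : Measure (ℝ × ℝ)) : EReal :=
  -DKL γ (volume.restrict unitSq) - DKL (barPlus γ) unif11 - DKL (barMinus γ) unif11
    + ((2 * Real.log 2 - 3 : ℝ) : EReal)

/-- The discrete approximation `H_q^N` of the Q-entropy. -/
def HqN (N : ℕ) (γ : Measure (ℝ × ℝ)) : ℝ :=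
  -(∑ i ∈ Finset.Icc 1 (2*N), ∑ j ∈ Finset.Icc 1 (2*N),
      (γ (INcell N i j)).toReal *
        Real.log ((γ (INcell N i j)).toReal / (volume (INcell N i j)).toReal))
  - (∑ i ∈ Finset.Icc 1 (2*N),
      (barPlus γ (JNcell N i)).toReal *
        Real.log ((2*N : ℝ) * (barPlus γ (JNcell N i)).toReal))
  - (∑ i ∈ Finset.Icc 1 (2*N),
      (barMinus γ (JNcell N i)).toReal *
        Real.log ((2*N : ℝ) * (barMinus γ (JNcell N i)).toReal))
  + 2 * Real.log 2 - 3

/-- An `n`-queens configuration: a subset of `[n]² = {1,…,n}²` with exactly one element in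
each row and column and at most one element in each plus- and minus-diagonal. -/
def IsQueensConfig (n : ℕ) (q : Finset (ℕ × ℕ)) : Prop :=
  (∀ p ∈ q, p.1 ∈ Finset.Icc 1 n ∧ p.2 ∈ Finset.Icc 1 n) ∧
  (∀ y ∈ Finset.Icc 1 n, ∃! x : ℕ, (x, y) ∈ q) ∧
  (∀ x ∈ Finset.Icc 1 n, ∃! y : ℕ, (x, y) ∈ q) ∧
  (∀ p ∈ q, ∀ p' ∈ q, p.1 + p.2 = p'.1 + p'.2 → p = p') ∧
  (∀ p ∈ q, ∀ p' ∈ q, (p.2 : ℤ) - (p.1 : ℤ) = (p'.2 : ℤ) - (p'.1 : ℤ) → p = p')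

/-- `Q(n)`, the number of `n`-queens configurations. -/
def numQueens (n : ℕ) : ℕ :=
  Set.ncard {q : Finset (ℕ × ℕ) | IsQueensConfig n q}

/-- The measure `γ_q` associated to an `n`-queens configuration `q`: density `n` on each
square `σ_{i,j}^n` with `(i,j) ∈ q`, and `0` elsewhere. -/
def gammaOf (n : ℕ) (q : Finset (ℕ × ℕ)) : Measure (ℝ × ℝ) :=
  volume.withDensity ((⋃ ij ∈ q, gridSq n ij.1 ij.2).indicator fun _ => (n : ℝ≥0∞))

/-- The set `B_n(γ,ε)` of `n`-queens configurations `q` with `d(γ_q, γ) < ε`. -/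
def Bset (n : ℕ) (γ : Measure (ℝ × ℝ)) (ε : ℝ) : Set (Finset (ℕ × ℕ)) :=
  {q | IsQueensConfig n q ∧ qdist (gammaOf n q) γ < ε}

/-- `|B_n(γ,ε)|`. -/
def Bcard (n : ℕ) (γ : Measure (ℝ × ℝ)) (ε : ℝ) : ℕ := (Bset n γ ε).ncard

/-- The exponential of an extended real, with `exp(−∞) = 0`. -/
def expEReal (x : EReal) : ℝ := if x = ⊥ then 0 else Real.exp x.toReal

lemma Real.measure_le_volume_of_Ioo {μ : Measure ℝ}
    (h : ∀ a b : ℝ, a < b → μ (Set.Ioo a b) ≤ ENNReal.ofReal (b - a)) : μ ≤ volume := by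
  have hIoc (a b : ℝ) : μ (Set.Ioc a b) ≤ ENNReal.ofReal (b - a) := by
    rcases le_or_gt b a with hab | hab
    · simp [Set.Ioc_eq_empty_of_le hab]
    · refine ENNReal.le_of_forall_pos_le_add fun δ hδ _ => ?_
      calc μ (Set.Ioc a b) ≤ μ (Set.Ioo a (b + δ)) :=
            measure_mono fun x hx => ⟨hx.1, hx.2.trans_lt (by simpa using hδ)⟩
        _ ≤ ENNReal.ofReal (b + δ - a) := h _ _ (by have : (0:ℝ) < δ := hδ; linarith)
        _ = ENNReal.ofReal (b - a) + δ := by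
            rw [show b + δ - a = (b - a) + (δ : ℝ) by ring,
              ENNReal.ofReal_add (by linarith) δ.coe_nonneg, ENNReal.ofReal_coe_nnreal]
  have houter : μ.toOuterMeasure ≤ StieltjesFunction.id.outer := by
    refine OuterMeasure.le_ofFunction.2 fun s => ?_
    rw [StieltjesFunction.length_eq]
    refine le_iInf₂ fun a b => le_iInf fun hs => ?_
    refine (measure_mono ?_).trans (hIoc a b)
    exact fun x hx => hs ⟨hx, not_isBot x⟩
  rw [Real.volume_eq_stieltjes_id]
  refine Measure.le_iff.2 fun s hs => ?_
  rw [StieltjesFunction.measure]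
  exact houter s

lemma isOpen_measure_le_of_mem_closure {Ω : Type*} [MeasurableSpace Ω] [TopologicalSpace Ω]
    [OpensMeasurableSpace Ω] [HasOuterApproxClosed Ω] {S : Set (ProbabilityMeasure Ω)}
    {γ : ProbabilityMeasure Ω} (hγ : γ ∈ closure S) {G : Set Ω} (hG : IsOpen G) {c : ℝ≥0∞}
    (h : ∀ μ ∈ S, μ.toMeasure G ≤ c) : γ.toMeasure G ≤ c := by
  have : (𝓝[S] γ).NeBot := mem_closure_iff_clusterPt.1 hγ
  have hlim : Tendsto (fun μ : ProbabilityMeasure Ω => μ) (𝓝[S] γ) (𝓝 γ) :=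
    tendsto_id.mono_left nhdsWithin_le_nhds
  refine (ProbabilityMeasure.le_liminf_measure_open_of_tendsto hlim hG).trans ?_
  refine liminf_le_of_frequently_le' (Eventually.frequently ?_)
  filter_upwards [self_mem_nhdsWithin] with μ hμ using h μ hμ

lemma isClosed_unitSq : IsClosed unitSq := isClosed_Icc.prod isClosed_Icc

lemma queenons_unitSq_compl {γ : ProbabilityMeasure (ℝ × ℝ)} (hγ : γ ∈ queenons) :
    γ.toMeasure unitSqᶜ = 0 := by
  refine le_antisymm (isOpen_measure_le_of_mem_closure hγ isClosed_unitSq.isOpen_compl ?_) bot_le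
  rintro μ ⟨⟨-, -, hμ, -⟩, -⟩
  exact hμ.2.1.le

lemma abs_diag_le_one_of_mem_unitSq {p : ℝ × ℝ} (hp : p ∈ unitSq) :
    |p.1 + p.2| ≤ 1 ∧ |p.2 - p.1| ≤ 1 := by
  obtain ⟨⟨h1, h2⟩, h3, h4⟩ := hp
  constructor <;> rw [abs_le] <;> constructor <;> linarith

lemma map_le_restrict_of_mem_closure {S : Set (ProbabilityMeasure (ℝ × ℝ))}
    {γ : ProbabilityMeasure (ℝ × ℝ)} (hγ : γ ∈ closure S) (hγS : γ.toMeasure unitSqᶜ = 0)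
    {u : ℝ × ℝ → ℝ} (hu : Continuous u) (hu1 : ∀ p ∈ unitSq, |u p| ≤ 1)
    (hS : ∀ μ ∈ S, μ.toMeasure unitSqᶜ = 0)
    (h : ∀ μ ∈ S, ∀ a b : ℝ, -1 ≤ a → a ≤ b → b ≤ 1 →
      μ.toMeasure {p ∈ unitSq | a ≤ u p ∧ u p ≤ b} ≤ ENNReal.ofReal (b - a)) :
    γ.toMeasure.map u ≤ volume.restrict (Set.Icc (-1:ℝ) 1) := by
  have hvol : γ.toMeasure.map u ≤ volume := by
    refine Real.measure_le_volume_of_Ioo fun a b _ => ?_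
    rw [Measure.map_apply hu.measurable measurableSet_Ioo]
    refine isOpen_measure_le_of_mem_closure hγ (isOpen_Ioo.preimage hu) fun μ hμ => ?_
    have hsub : u ⁻¹' Set.Ioo a b ⊆
        {p ∈ unitSq | max a (-1) ≤ u p ∧ u p ≤ min b 1} ∪ unitSqᶜ := by
      intro p hp
      by_cases hpS : p ∈ unitSq
      · have := abs_le.1 (hu1 p hpS)
        exact Or.inl ⟨hpS, max_le hp.1.le this.1, le_min hp.2.le this.2⟩
      · exact Or.inr hpS
    refine (measure_mono hsub).trans ((measure_union_le _ _).trans ?_)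
    rw [hS μ hμ, add_zero]
    rcases le_or_gt (max a (-1)) (min b 1) with hle | hlt
    · refine (h μ hμ _ _ (le_max_right _ _) hle (min_le_right _ _)).trans ?_
      exact ENNReal.ofReal_le_ofReal (sub_le_sub (min_le_left _ _) (le_max_left _ _))
    · refine le_of_eq_of_le ?_ bot_le
      rw [bot_eq_zero, ← measure_empty (μ := μ.toMeasure)]
      congr 1
      ext p
      simp only [Set.mem_ofPred_eq, Set.mem_empty_iff_false, iff_false]
      rintro ⟨-, h1, h2⟩
      exact absurd (h1.trans h2) hlt.not_ge
  refine Measure.le_iff.2 fun s hs => ?_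
  rw [Measure.restrict_apply hs]
  refine le_trans ?_ (hvol _)
  rw [Measure.map_apply hu.measurable hs,
    Measure.map_apply hu.measurable (hs.inter measurableSet_Icc)]
  refine (measure_mono (t := u ⁻¹' (s ∩ Set.Icc (-1) 1) ∪ unitSqᶜ) fun p hp => ?_).trans
    ((measure_union_le _ _).trans (by rw [hγS, add_zero]))
  by_cases hpS : p ∈ unitSq
  · exact Or.inl ⟨hp, abs_le.1 (hu1 p hpS)⟩
  · exact Or.inr hpS

lemma diagPlus_le {γ : ProbabilityMeasure (ℝ × ℝ)} (hγ : γ ∈ queenons) :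
    diagPlus γ.toMeasure ≤ volume.restrict (Set.Icc (-1:ℝ) 1) := by
  refine map_le_restrict_of_mem_closure hγ (queenons_unitSq_compl hγ) (by fun_prop)
    (fun p hp => (abs_diag_le_one_of_mem_unitSq hp).1) ?_ ?_
  · rintro μ ⟨⟨-, -, hμ, -⟩, -⟩
    exact hμ.2.1
  · rintro μ ⟨-, hμ⟩ a b ha hab hb
    exact (hμ a b ha hab hb).1

lemma diagMinus_le {γ : ProbabilityMeasure (ℝ × ℝ)} (hγ : γ ∈ queenons) :
    diagMinus γ.toMeasure ≤ volume.restrict (Set.Icc (-1:ℝ) 1) := by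
  refine map_le_restrict_of_mem_closure hγ (queenons_unitSq_compl hγ) (by fun_prop)
    (fun p hp => (abs_diag_le_one_of_mem_unitSq hp).2) ?_ ?_
  · rintro μ ⟨⟨-, -, hμ, -⟩, -⟩
    exact hμ.2.1
  · rintro μ ⟨-, hμ⟩ a b ha hab hb
    exact (hμ a b ha hab hb).2

lemma abs_mul_log_sub_mul_log_le {x y ε : ℝ} (hx0 : 0 ≤ x) (hx1 : x ≤ 1) (hy0 : 0 ≤ y)
    (hy1 : y ≤ 1) (hxy : |x - y| ≤ ε) (hε₀ : 0 < ε) (hε : Real.log ε ≤ -1) :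
    |x * Real.log x - y * Real.log y| ≤ -(ε * Real.log ε) := by
  wlog hle : x ≤ y generalizing x y with H
  · rw [abs_sub_comm]
    exact H hy0 hy1 hx0 hx1 (by rwa [abs_sub_comm]) (le_of_not_ge hle)
  rcases hle.eq_or_lt with rfl | hlt
  · simp only [sub_self, abs_zero]; nlinarith
  have hy : 0 < y := hx0.trans_lt hlt
  obtain ⟨d, hd⟩ : ∃ d, d = y - x := ⟨_, rfl⟩
  have hd0 : 0 < d := by linarith
  have hdε : d ≤ ε := by rw [abs_sub_comm, abs_of_pos (by linarith)] at hxy; linarith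
  have hlogy : Real.log y ≤ 0 := Real.log_nonpos hy0 hy1
  have key {a b : ℝ} (ha : 0 ≤ a) (hb : 0 < b) : a * Real.log b - a * Real.log a ≤ b - a := by
    rcases ha.eq_or_lt with rfl | ha
    · simpa using hb.le
    · have := Real.log_le_sub_one_of_pos (div_pos hb ha)
      rw [Real.log_div hb.ne' ha.ne'] at this
      have := mul_le_mul_of_nonneg_left this ha.le
      rw [mul_sub, mul_sub, mul_div_cancel₀ _ ha.ne'] at this
      linarith
  have hmono {a : ℝ} (ha : 0 ≤ a) (hay : a ≤ y) : a * Real.log a ≤ a * Real.log y := by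
    rcases ha.eq_or_lt with rfl | ha
    · simp
    · exact mul_le_mul_of_nonneg_left (Real.log_le_log ha hay) ha.le
  have k1 := key hx0 hy
  have k2 := key hd0.le hε₀
  have m1 := hmono hx0 hle
  have m2 := hmono hd0.le (by linarith)
  have hyd : y = x + d := by linarith
  have e1 : y * Real.log y = x * Real.log y + d * Real.log y := by rw [← add_mul, ← hyd]
  rw [abs_le]
  constructor
  · nlinarith
  · nlinarith [mul_nonneg (sub_nonneg.2 hdε) (by linarith : 0 ≤ -Real.log ε - 1)]

lemma sum_measure_Icc_consecutive {ν : Measure ℝ} [IsFiniteMeasure ν] [NullSingletonClass ν] (a h : ℝ)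
    (hh : 0 ≤ h) (n : ℕ) :
    ∑ i ∈ Finset.Icc 1 n, (ν (Set.Icc (a + ((i:ℝ) - 1) * h) (a + i * h))).toReal =
      (ν (Set.Icc a (a + n * h))).toReal := by
  induction n with
  | zero => simp
  | succ n ih =>
    rw [Finset.sum_Icc_succ_top (by omega), ih, ← ENNReal.toReal_add (by simp) (by simp)]
    congr 1
    rw [← measure_congr (Ioc_ae_eq_Icc (α := ℝ) (μ := ν) (a := a + ((↑(n + 1):ℝ) - 1) * h)),
      ← measure_union _ measurableSet_Ioc]
    · congr 1
      push_cast
      rw [add_sub_cancel_right]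
      exact Set.Icc_union_Ioc_eq_Icc (by nlinarith [n.cast_nonneg (α := ℝ)]) (by nlinarith)
    · rw [Set.disjoint_left]
      intro x hx hx'
      have := hx.2
      have := hx'.1
      push_cast at *
      linarith

lemma sum_measure_JNcell {ν : Measure ℝ} [IsFiniteMeasure ν] [NullSingletonClass ν] {N : ℕ} (hN : 0 < N) :
    ∑ i ∈ Finset.Icc 1 (2*N), (ν (JNcell N i)).toReal = (ν (Set.Icc (-1) 1)).toReal := by
  have hN' : (N:ℝ) ≠ 0 := by positivity
  have := sum_measure_Icc_consecutive (ν := ν) (-1) ((N:ℝ)⁻¹) (by positivity) (2*N)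
  simp only [JNcell, div_eq_mul_inv]
  rw [this]
  congr 3
  push_cast
  field_simp
  norm_num

lemma mem_unitSq_iff (p : ℝ × ℝ) : p ∈ unitSq ↔ |p.1 + p.2| + |p.2 - p.1| ≤ 1 := by
  simp only [unitSq, Set.mem_prod, Set.mem_Icc]
  constructor
  · rintro ⟨⟨h1, h2⟩, h3, h4⟩
    rcases abs_cases (p.1 + p.2) with h | h <;> rcases abs_cases (p.2 - p.1) with h' | h' <;>
      linarith
  · intro h
    have h1 := neg_abs_le (p.1 + p.2)
    have h2 := le_abs_self (p.1 + p.2)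
    have h3 := neg_abs_le (p.2 - p.1)
    have h4 := le_abs_self (p.2 - p.1)
    exact ⟨⟨by linarith, by linarith⟩, by linarith, by linarith⟩

lemma volume_diag_rectangle (a b c d : ℝ) (hab : a ≤ b) :
    volume {p : ℝ × ℝ | (a ≤ p.1 + p.2 ∧ p.1 + p.2 ≤ b) ∧ (c ≤ p.2 - p.1 ∧ p.2 - p.1 ≤ d)} =
      ENNReal.ofReal ((b - a) * (d - c) / 2) := by
  set f : (ℝ × ℝ) →ₗ[ℝ] (ℝ × ℝ) :=
    Matrix.toLin (Module.Basis.finTwoProd ℝ) (Module.Basis.finTwoProd ℝ) !![1, 1; -1, 1] with hf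
  have hdet : LinearMap.det f = 2 := by
    rw [hf, LinearMap.det_toLin, Matrix.det_fin_two_of]
    norm_num
  have hpre : {p : ℝ × ℝ | (a ≤ p.1 + p.2 ∧ p.1 + p.2 ≤ b) ∧
      (c ≤ p.2 - p.1 ∧ p.2 - p.1 ≤ d)} = f ⁻¹' (Set.Icc a b ×ˢ Set.Icc c d) := by
    ext p
    have h1 : f p = (p.1 + p.2, p.2 - p.1) := by
      rw [hf, Matrix.toLin_finTwoProd_apply]
      ext
      · simp
      · simp; ring
    rw [Set.mem_preimage, h1]
    rfl
  rw [hpre, Measure.addHaar_preimage_linearMap volume (by rw [hdet]; norm_num), hdet,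
    Measure.volume_eq_prod, Measure.prod_prod, Real.volume_Icc, Real.volume_Icc,
    ← ENNReal.ofReal_mul (by linarith), ← ENNReal.ofReal_mul (by positivity),
    abs_of_pos (by norm_num)]
  congr 1
  ring

lemma exists_abs_form {N i : ℕ} (hN : 0 < N) (hi : i ∈ Finset.Icc 1 (2*N)) :
    ∃ k : ℕ, ∃ σ : ℝ, (σ = 1 ∨ σ = -1) ∧
      ∀ u : ℝ, (-1 + ((i:ℝ) - 1)/N ≤ u ∧ u ≤ -1 + (i:ℝ)/N) ↔
        ((k:ℝ)/N ≤ σ * u ∧ σ * u ≤ ((k:ℝ) + 1)/N) := by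
  have hN' : (0:ℝ) < N := by exact_mod_cast hN
  rw [Finset.mem_Icc] at hi
  rcases le_or_gt i N with h | h
  · refine ⟨N - i, -1, Or.inr rfl, fun u => ?_⟩
    have e1 : (((N - i : ℕ):ℝ))/N = 1 - (i:ℝ)/N := by
      rw [Nat.cast_sub h]; field_simp
    have e2 : (((N - i : ℕ):ℝ) + 1)/N = 1 - ((i:ℝ) - 1)/N := by
      rw [Nat.cast_sub h]; field_simp; ring
    rw [e1, e2]
    constructor <;> rintro ⟨h1, h2⟩ <;> constructor <;> linarith
  · refine ⟨i - 1 - N, 1, Or.inl rfl, fun u => ?_⟩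
    have e0 : ((i - 1 - N : ℕ):ℝ) = (i:ℝ) - 1 - N := by
      rw [Nat.cast_sub (by omega), Nat.cast_sub hi.1]; simp
    have e1 : ((i:ℝ) - 1 - N)/N = -1 + ((i:ℝ) - 1)/N := by
      field_simp; ring
    have e2 : ((i:ℝ) - 1 - N + 1)/N = -1 + (i:ℝ)/N := by
      field_simp; ring
    rw [e0, e1, e2, one_mul]

lemma abs_eq_mul_of_nonneg {σ u : ℝ} (hσ : σ = 1 ∨ σ = -1) (h : 0 ≤ σ * u) : |u| = σ * u := by
  rcases hσ with rfl | rfl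
  · rw [one_mul] at *; exact abs_of_nonneg h
  · rw [neg_one_mul] at *; exact abs_of_nonpos (by linarith)

lemma measurableSet_INcell (N i j : ℕ) : MeasurableSet (INcell N i j) := by
  refine isClosed_unitSq.measurableSet.inter (MeasurableSet.inter ?_ ?_)
  · exact measurableSet_Icc.preimage (measurable_fst.add measurable_snd)
  · exact measurableSet_Icc.preimage (measurable_snd.sub measurable_fst)

/-- A cell of the partition is degenerate, or fills at least half of a diagonal rectangle. -/
lemma INcell_degenerate_or_volume {N i j : ℕ} (hN : 0 < N) (hi : i ∈ Finset.Icc 1 (2*N))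
    (hj : j ∈ Finset.Icc 1 (2*N)) :
    (∃ c : ℝ, INcell N i j ⊆ {p | p.1 + p.2 = c}) ∨
      (1 / (4 * (N:ℝ)^2) ≤ (volume (INcell N i j)).toReal ∧
        (volume (INcell N i j)).toReal ≤ 1 / (2 * (N:ℝ)^2)) := by
  have hN' : (0:ℝ) < N := by exact_mod_cast hN
  obtain ⟨k, σ, hσ, hu⟩ := exists_abs_form hN hi
  obtain ⟨l, τ, hτ, hv⟩ := exists_abs_form hN hj
  have hσσ : σ * σ = 1 := by rcases hσ with rfl | rfl <;> norm_num
  have hττ : τ * τ = 1 := by rcases hτ with rfl | rfl <;> norm_num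
  have hk0 : (0:ℝ) ≤ k / N := by positivity
  have hl0 : (0:ℝ) ≤ l / N := by positivity
  set Q : Set (ℝ × ℝ) := {p | (-1 + ((i:ℝ) - 1)/N ≤ p.1 + p.2 ∧ p.1 + p.2 ≤ -1 + (i:ℝ)/N) ∧
    (-1 + ((j:ℝ) - 1)/N ≤ p.2 - p.1 ∧ p.2 - p.1 ≤ -1 + (j:ℝ)/N)} with hQ
  have hQmem (p : ℝ × ℝ) : p ∈ Q ↔
      ((k:ℝ)/N ≤ σ * (p.1 + p.2) ∧ σ * (p.1 + p.2) ≤ ((k:ℝ) + 1)/N) ∧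
      ((l:ℝ)/N ≤ τ * (p.2 - p.1) ∧ τ * (p.2 - p.1) ≤ ((l:ℝ) + 1)/N) := by
    rw [← hu, ← hv]; rfl
  have hcell : INcell N i j = unitSq ∩ Q := rfl
  have hQS {p : ℝ × ℝ} (hp : p ∈ Q) :
      p ∈ unitSq ↔ σ * (p.1 + p.2) + τ * (p.2 - p.1) ≤ 1 := by
    rw [hQmem] at hp
    rw [mem_unitSq_iff, abs_eq_mul_of_nonneg hσ (hk0.trans hp.1.1),
      abs_eq_mul_of_nonneg hτ (hl0.trans hp.2.1)]
  rcases le_or_gt N (k + l) with hkl | hkl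
  · left
    have hkl' : (1:ℝ) ≤ k / N + l / N := by
      rw [← add_div, le_div_iff₀ hN', one_mul]; exact_mod_cast hkl
    refine ⟨σ * (k / N), fun p hp => ?_⟩
    rw [hcell] at hp
    have h1 := (hQS hp.2).1 hp.1
    have h2 := (hQmem p).1 hp.2
    have h3 : σ * (p.1 + p.2) = k / N := by linarith [h2.1.1, h2.2.1]
    show p.1 + p.2 = _
    rw [← h3, ← mul_assoc, hσσ, one_mul]
  · right
    have hkl' : ((k:ℝ) + 1) / N + l / N ≤ 1 := by
      rw [← add_div, div_le_one₀ hN']; exact_mod_cast (by omega : k + 1 + l ≤ N)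
    have hvolQ : volume Q = ENNReal.ofReal (1 / (2 * (N:ℝ)^2)) := by
      rw [hQ, volume_diag_rectangle]
      · congr 1; field_simp; ring
      · have : ((i:ℝ) - 1)/N ≤ (i:ℝ)/N := by gcongr; linarith
        linarith
    have hle : volume (INcell N i j) ≤ volume Q := measure_mono Set.inter_subset_right
    have hfin : volume (INcell N i j) ≠ ∞ := (hle.trans_lt (by rw [hvolQ]; exact ENNReal.ofReal_lt_top)).ne
    set c : ℝ × ℝ := ((σ * ((2*k + 1)/N) - τ * ((2*l + 1)/N)) / 2,
      (σ * ((2*k + 1)/N) + τ * ((2*l + 1)/N)) / 2) with hc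
    have hmeas := measurableSet_INcell N i j
    have hcover : Q ⊆ INcell N i j ∪ (fun p => c - p) ⁻¹' INcell N i j := by
      intro p hp
      have e1 : σ * ((c - p).1 + (c - p).2) = (2*k + 1)/N - σ * (p.1 + p.2) := by
        simp only [hc, Prod.fst_sub, Prod.snd_sub]
        linear_combination ((2*k + 1)/N) * hσσ
      have e2 : τ * ((c - p).2 - (c - p).1) = (2*l + 1)/N - τ * (p.2 - p.1) := by
        simp only [hc, Prod.fst_sub, Prod.snd_sub]
        linear_combination ((2*l + 1)/N) * hττ
      have d1 : (2*(k:ℝ) + 1)/N = k/N + (k + 1)/N := by ring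
      have d2 : (2*(l:ℝ) + 1)/N = l/N + (l + 1)/N := by ring
      have d3 : ((l:ℝ) + 1)/N - l/N = (k + 1)/N - k/N := by ring
      have hp' := (hQmem p).1 hp
      have hcp : c - p ∈ Q := by
        rw [hQmem, e1, e2]
        obtain ⟨⟨h1, h2⟩, h3, h4⟩ := hp'
        exact ⟨⟨by linarith, by linarith⟩, by linarith, by linarith⟩
      rcases le_or_gt (σ * (p.1 + p.2) + τ * (p.2 - p.1)) 1 with h | h
      · exact Or.inl ⟨(hQS hp).2 h, hp⟩
      · refine Or.inr ⟨(hQS hcp).2 ?_, hcp⟩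
        rw [e1, e2]
        linarith
    have hpres : volume ((fun p => c - p) ⁻¹' INcell N i j) = volume (INcell N i j) :=
      (Measure.measurePreserving_sub_left volume c).measure_preimage hmeas.nullMeasurableSet
    have h2 : volume Q ≤ volume (INcell N i j) + volume (INcell N i j) :=
      (measure_mono hcover).trans ((measure_union_le _ _).trans (by rw [hpres]))
    have hr1 := ENNReal.toReal_mono (by rw [hvolQ]; exact ENNReal.ofReal_ne_top) hle
    have hr2 := ENNReal.toReal_mono (ENNReal.add_ne_top.2 ⟨hfin, hfin⟩) h2
    rw [ENNReal.toReal_add hfin hfin] at hr2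
    rw [hvolQ, ENNReal.toReal_ofReal (by positivity)] at hr1 hr2
    refine ⟨?_, hr1⟩
    have : 1 / (4 * (N:ℝ)^2) = 1 / (2 * (N:ℝ)^2) / 2 := by field_simp; norm_num
    linarith

lemma nullSingletonClass_of_le_restrict {ν : Measure ℝ} {s : Set ℝ}
    (h : ν ≤ volume.restrict s) : NullSingletonClass ν :=
  ⟨fun x => le_antisymm ((h {x}).trans (by simp)) bot_le⟩

lemma measurableSet_JNcell (N i : ℕ) : MeasurableSet (JNcell N i) := measurableSet_Icc

lemma measure_INcell_eq {γ : Measure (ℝ × ℝ)} (hS : γ unitSqᶜ = 0) (N i j : ℕ) :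
    γ (INcell N i j) = ((γ.restrict ((fun p => p.1 + p.2) ⁻¹' JNcell N i)).map
      fun p => p.2 - p.1) (JNcell N j) := by
  rw [Measure.map_apply (by fun_prop) (measurableSet_JNcell N j),
    Measure.restrict_apply ((measurableSet_JNcell N j).preimage (by fun_prop))]
  have hae : ∀ᵐ p ∂γ, p ∈ unitSq := hS
  refine measure_congr ?_
  filter_upwards [hae] with p hp
  exact propext ⟨fun h => ⟨h.2.2, h.2.1⟩, fun h => ⟨hp, h.2, h.1⟩⟩

lemma diag_Icc_eq_measure_Rset {γ : Measure (ℝ × ℝ)} (hS : γ unitSqᶜ = 0) (a b : ℝ) :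
    diagPlus γ (Set.Icc a b) = γ (Rset a b (-1) 1) ∧
      diagMinus γ (Set.Icc a b) = γ (Rset (-1) 1 a b) := by
  have hae : ∀ᵐ p ∂γ, p ∈ unitSq := hS
  constructor
  · rw [diagPlus, Measure.map_apply (by fun_prop) measurableSet_Icc]
    refine measure_congr ?_
    filter_upwards [hae] with p hp
    exact propext ⟨fun h => ⟨hp, h, abs_le.1 (abs_diag_le_one_of_mem_unitSq hp).2⟩,
      fun h => h.2.1⟩
  · rw [diagMinus, Measure.map_apply (by fun_prop) measurableSet_Icc]
    refine measure_congr ?_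
    filter_upwards [hae] with p hp
    exact propext ⟨fun h => ⟨hp, abs_le.1 (abs_diag_le_one_of_mem_unitSq hp).1, h⟩,
      fun h => h.2.2⟩

lemma diag_Icc_neg_one_one {γ : Measure (ℝ × ℝ)} [IsProbabilityMeasure γ]
    (hS : γ unitSqᶜ = 0) :
    diagPlus γ (Set.Icc (-1) 1) = 1 ∧ diagMinus γ (Set.Icc (-1) 1) = 1 := by
  have hae : ∀ᵐ p ∂γ, p ∈ unitSq := hS
  have hR : γ (Rset (-1) 1 (-1) 1) = 1 := by
    rw [← measure_univ (μ := γ)]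
    refine measure_congr ?_
    filter_upwards [hae] with p hp
    have := abs_diag_le_one_of_mem_unitSq hp
    exact propext ⟨fun _ => trivial, fun _ => ⟨hp, abs_le.1 this.1, abs_le.1 this.2⟩⟩
  rw [(diag_Icc_eq_measure_Rset hS _ _).1, (diag_Icc_eq_measure_Rset hS _ _).2]
  exact ⟨hR, hR⟩

lemma sum_measure_INcell {γ : Measure (ℝ × ℝ)} [IsProbabilityMeasure γ]
    (hS : γ unitSqᶜ = 0) (hp : diagPlus γ ≤ volume.restrict (Set.Icc (-1:ℝ) 1))
    (hm : diagMinus γ ≤ volume.restrict (Set.Icc (-1:ℝ) 1)) {N : ℕ} (hN : 0 < N) :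
    ∑ i ∈ Finset.Icc 1 (2*N), ∑ j ∈ Finset.Icc 1 (2*N), (γ (INcell N i j)).toReal = 1 := by
  have := nullSingletonClass_of_le_restrict hp
  have : IsFiniteMeasure (diagPlus γ) := by unfold diagPlus; infer_instance
  have hrow (i : ℕ) : ∑ j ∈ Finset.Icc 1 (2*N), (γ (INcell N i j)).toReal =
      (diagPlus γ (JNcell N i)).toReal := by
    simp only [measure_INcell_eq hS]
    have hle : (γ.restrict ((fun p => p.1 + p.2) ⁻¹' JNcell N i)).map (fun p => p.2 - p.1) ≤
        diagMinus γ := Measure.map_mono Measure.restrict_le_self (by fun_prop)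
    have := nullSingletonClass_of_le_restrict (hle.trans hm)
    rw [sum_measure_JNcell hN, diagPlus, Measure.map_apply (by fun_prop) (measurableSet_JNcell N i),
      Measure.map_apply (by fun_prop) measurableSet_Icc,
      Measure.restrict_apply (measurableSet_Icc.preimage (by fun_prop))]
    congr 1
    have hae : ∀ᵐ p ∂γ, p ∈ unitSq := hS
    refine measure_congr ?_
    filter_upwards [hae] with p hp
    exact propext ⟨fun h => h.2,
      fun h => ⟨abs_le.1 (abs_diag_le_one_of_mem_unitSq hp).2, h⟩⟩
  simp only [hrow]
  rw [sum_measure_JNcell hN, (diag_Icc_neg_one_one hS).1, ENNReal.toReal_one]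

lemma JNcell_endpoints {N i : ℕ} (hN : 0 < N) (hi : i ∈ Finset.Icc 1 (2*N)) :
    -1 + ((i:ℝ) - 1)/N ∈ Set.Icc (-1:ℝ) 1 ∧ -1 + (i:ℝ)/N ∈ Set.Icc (-1:ℝ) 1 := by
  have hN' : (0:ℝ) < N := by exact_mod_cast hN
  rw [Finset.mem_Icc] at hi
  have h1 : (1:ℝ) ≤ i := by exact_mod_cast hi.1
  have h2 : (i:ℝ) ≤ 2 * N := by exact_mod_cast hi.2
  have h3 : ((i:ℝ) - 1)/N ≤ (i:ℝ)/N := by gcongr; linarith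
  have h4 : (0:ℝ) ≤ ((i:ℝ) - 1)/N := div_nonneg (by linarith) hN'.le
  have h5 : (i:ℝ)/N ≤ 2 := (div_le_iff₀ hN').2 h2
  exact ⟨⟨by linarith, by linarith⟩, by linarith, by linarith⟩

lemma toReal_restrict_sub_JNcell {ν : Measure ℝ} [IsFiniteMeasure ν]
    (h : ν ≤ volume.restrict (Set.Icc (-1:ℝ) 1)) {N i : ℕ} (hN : 0 < N)
    (hi : i ∈ Finset.Icc 1 (2*N)) :
    ((volume.restrict (Set.Icc (-1:ℝ) 1) - ν) (JNcell N i)).toReal =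
      1 / N - (ν (JNcell N i)).toReal := by
  have hvol : volume.restrict (Set.Icc (-1:ℝ) 1) (JNcell N i) = ENNReal.ofReal (1 / N) := by
    obtain ⟨h1, h2⟩ := JNcell_endpoints hN hi
    rw [Measure.restrict_apply (measurableSet_JNcell N i), JNcell,
      Set.inter_eq_left.2 (Set.Icc_subset_Icc h1.1 h2.2), Real.volume_Icc]
    congr 1
    ring
  rw [Measure.sub_apply (measurableSet_JNcell N i) h,
    ENNReal.toReal_sub_of_le (h _) (by simp [hvol]),
    hvol, ENNReal.toReal_ofReal (by positivity)]

lemma abs_sub_measure_Rset_le_qdist {μ ν : Measure (ℝ × ℝ)} [IsProbabilityMeasure μ]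
    [IsProbabilityMeasure ν] {a₁ b₁ a₂ b₂ : ℝ} (h₁ : a₁ ∈ Set.Icc (-1:ℝ) 1)
    (h₂ : b₁ ∈ Set.Icc (-1:ℝ) 1) (h₃ : a₂ ∈ Set.Icc (-1:ℝ) 1) (h₄ : b₂ ∈ Set.Icc (-1:ℝ) 1) :
    |(μ (Rset a₁ b₁ a₂ b₂)).toReal - (ν (Rset a₁ b₁ a₂ b₂)).toReal| ≤ qdist μ ν := by
  refine le_csSup ⟨1, ?_⟩ ⟨a₁, b₁, a₂, b₂, h₁, h₂, h₃, h₄, rfl⟩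
  rintro t ⟨a, b, c, d, -, -, -, -, rfl⟩
  have h1 : (μ (Rset a b c d)).toReal ≤ 1 := measureReal_le_one
  have h2 : (ν (Rset a b c d)).toReal ≤ 1 := measureReal_le_one
  have h3 : 0 ≤ (μ (Rset a b c d)).toReal := ENNReal.toReal_nonneg
  have h4 : 0 ≤ (ν (Rset a b c d)).toReal := ENNReal.toReal_nonneg
  rw [abs_le]
  constructor <;> linarith

/-- Continuity of the weighted entropy `∑ (p log p + p w)` on vectors of equal total mass. -/
lemma abs_sum_entropy_sub_le {ι : Type*} (S : Finset ι) {p q w : ι → ℝ} {ε c r : ℝ}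
    (hp : ∀ i ∈ S, 0 ≤ p i ∧ p i ≤ 1) (hq : ∀ i ∈ S, 0 ≤ q i ∧ q i ≤ 1)
    (hpq : ∀ i ∈ S, |p i - q i| ≤ ε) (hsum : ∑ i ∈ S, p i = ∑ i ∈ S, q i)
    (hw : ∀ i ∈ S, |w i - c| ≤ r) (hε₀ : 0 < ε) (hε : Real.log ε ≤ -1) :
    |∑ i ∈ S, (p i * Real.log (p i) + p i * w i) - ∑ i ∈ S, (q i * Real.log (q i) + q i * w i)| ≤
      S.card * (ε * (-Real.log ε + r)) := by
  have key : ∑ i ∈ S, (p i * Real.log (p i) + p i * w i) -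
      ∑ i ∈ S, (q i * Real.log (q i) + q i * w i) =
      ∑ i ∈ S, ((p i * Real.log (p i) - q i * Real.log (q i)) + (p i - q i) * (w i - c)) := by
    have h0 : ∑ i ∈ S, (p i - q i) * c = 0 := by
      rw [← Finset.sum_mul, Finset.sum_sub_distrib, hsum, sub_self, zero_mul]
    rw [← Finset.sum_sub_distrib, ← sub_zero (∑ i ∈ S, (_ - _)), ← h0, ← Finset.sum_sub_distrib]
    refine Finset.sum_congr rfl fun i _ => ?_
    ring
  rw [key, ← nsmul_eq_mul]
  refine (Finset.abs_sum_le_sum_abs _ _).trans (Finset.sum_le_card_nsmul _ _ _ fun i hi => ?_)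
  refine (abs_add_le _ _).trans ?_
  have h1 := abs_mul_log_sub_mul_log_le (hp i hi).1 (hp i hi).2 (hq i hi).1 (hq i hi).2
    (hpq i hi) hε₀ hε
  have h2 : |(p i - q i) * (w i - c)| ≤ ε * r := by
    rw [abs_mul]
    exact mul_le_mul (hpq i hi) (hw i hi) (abs_nonneg _) hε₀.le
  linarith

lemma abs_sum_bar_entropy_sub_le {ν₁ ν₂ : Measure ℝ} [IsProbabilityMeasure ν₁]
    [IsProbabilityMeasure ν₂] (h₁ : ν₁ ≤ volume.restrict (Set.Icc (-1:ℝ) 1))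
    (h₂ : ν₂ ≤ volume.restrict (Set.Icc (-1:ℝ) 1)) {N : ℕ} (hN : 0 < N)
    (hm₁ : ν₁ (Set.Icc (-1) 1) = 1) (hm₂ : ν₂ (Set.Icc (-1) 1) = 1) {ε : ℝ}
    (hd : ∀ i ∈ Finset.Icc 1 (2*N), |(ν₁ (JNcell N i)).toReal - (ν₂ (JNcell N i)).toReal| ≤ ε)
    (hε₀ : 0 < ε) (hε : Real.log ε ≤ -1) :
    |∑ i ∈ Finset.Icc 1 (2*N), ((volume.restrict (Set.Icc (-1:ℝ) 1) - ν₁) (JNcell N i)).toReal *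
        Real.log ((2*N : ℝ) * ((volume.restrict (Set.Icc (-1:ℝ) 1) - ν₁) (JNcell N i)).toReal) -
      ∑ i ∈ Finset.Icc 1 (2*N), ((volume.restrict (Set.Icc (-1:ℝ) 1) - ν₂) (JNcell N i)).toReal *
        Real.log ((2*N : ℝ) * ((volume.restrict (Set.Icc (-1:ℝ) 1) - ν₂) (JNcell N i)).toReal)| ≤
      2 * N * (ε * -Real.log ε) := by
  have hN' : (1:ℝ) ≤ N := by exact_mod_cast hN
  have := nullSingletonClass_of_le_restrict h₁
  have := nullSingletonClass_of_le_restrict h₂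
  have hsplit (x : ℝ) : x * Real.log ((2*N : ℝ) * x) =
      x * Real.log x + x * Real.log (2*N : ℝ) := by
    rcases eq_or_ne x 0 with rfl | hx
    · simp
    · rw [Real.log_mul (by positivity) hx]; ring
  have hmem {ν : Measure ℝ} [IsFiniteMeasure ν] (h : ν ≤ volume.restrict (Set.Icc (-1:ℝ) 1))
      (i : ℕ) (hi : i ∈ Finset.Icc 1 (2*N)) :
      0 ≤ ((volume.restrict (Set.Icc (-1:ℝ) 1) - ν) (JNcell N i)).toReal ∧
        ((volume.restrict (Set.Icc (-1:ℝ) 1) - ν) (JNcell N i)).toReal ≤ 1 := by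
    refine ⟨ENNReal.toReal_nonneg, ?_⟩
    rw [toReal_restrict_sub_JNcell h hN hi]
    have h1 : 1 / (N:ℝ) ≤ 1 := (div_le_one₀ (by linarith)).2 hN'
    linarith [(ENNReal.toReal_nonneg : 0 ≤ (ν (JNcell N i)).toReal)]
  simp only [hsplit]
  refine (abs_sum_entropy_sub_le (Finset.Icc 1 (2*N)) (c := Real.log (2*N : ℝ)) (r := 0)
    (hmem h₁) (hmem h₂) ?_ ?_ (by simp) hε₀ hε).trans_eq (by simp)
  · intro i hi
    rw [toReal_restrict_sub_JNcell h₁ hN hi, toReal_restrict_sub_JNcell h₂ hN hi,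
      sub_sub_sub_cancel_left, abs_sub_comm]
    exact hd i hi
  · rw [Finset.sum_congr rfl fun i hi => toReal_restrict_sub_JNcell h₁ hN hi,
      Finset.sum_congr rfl fun i hi => toReal_restrict_sub_JNcell h₂ hN hi,
      Finset.sum_sub_distrib, Finset.sum_sub_distrib, sum_measure_JNcell hN,
      sum_measure_JNcell hN, hm₁, hm₂]

lemma measure_INcell_eq_zero_of_degenerate {γ : Measure (ℝ × ℝ)}
    (hp : diagPlus γ ≤ volume.restrict (Set.Icc (-1:ℝ) 1)) {N i j : ℕ}
    (h : ∃ c : ℝ, INcell N i j ⊆ {p | p.1 + p.2 = c}) : γ (INcell N i j) = 0 := by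
  obtain ⟨c, hc⟩ := h
  have := nullSingletonClass_of_le_restrict hp
  refine measure_mono_null hc ?_
  have h0 := measure_singleton (μ := diagPlus γ) c
  rwa [diagPlus, Measure.map_apply (by fun_prop) (measurableSet_singleton c)] at h0

lemma abs_sum_cell_entropy_sub_le {γ₁ γ₂ : Measure (ℝ × ℝ)} [IsProbabilityMeasure γ₁]
    [IsProbabilityMeasure γ₂] (hS₁ : γ₁ unitSqᶜ = 0) (hS₂ : γ₂ unitSqᶜ = 0)
    (hp₁ : diagPlus γ₁ ≤ volume.restrict (Set.Icc (-1:ℝ) 1))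
    (hp₂ : diagPlus γ₂ ≤ volume.restrict (Set.Icc (-1:ℝ) 1))
    (hm₁ : diagMinus γ₁ ≤ volume.restrict (Set.Icc (-1:ℝ) 1))
    (hm₂ : diagMinus γ₂ ≤ volume.restrict (Set.Icc (-1:ℝ) 1)) {N : ℕ} (hN : 0 < N) {ε : ℝ}
    (h : qdist γ₁ γ₂ ≤ ε) (hε₀ : 0 < ε) (hε : Real.log ε ≤ -1) :
    |∑ i ∈ Finset.Icc 1 (2*N), ∑ j ∈ Finset.Icc 1 (2*N), (γ₁ (INcell N i j)).toReal *
        Real.log ((γ₁ (INcell N i j)).toReal / (volume (INcell N i j)).toReal) -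
      ∑ i ∈ Finset.Icc 1 (2*N), ∑ j ∈ Finset.Icc 1 (2*N), (γ₂ (INcell N i j)).toReal *
        Real.log ((γ₂ (INcell N i j)).toReal / (volume (INcell N i j)).toReal)| ≤
      4 * N^2 * (ε * (-Real.log ε + Real.log 2 / 2)) := by
  classical
  have hN' : (0:ℝ) < N := by exact_mod_cast hN
  set c : ℝ := Real.log (2 * (N:ℝ)^2) + Real.log 2 / 2 with hc
  set S := Finset.Icc 1 (2*N) ×ˢ Finset.Icc 1 (2*N) with hSdef
  set w : ℕ × ℕ → ℝ := fun x => if ∃ t : ℝ, INcell N x.1 x.2 ⊆ {p | p.1 + p.2 = t} then c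
    else -Real.log (volume (INcell N x.1 x.2)).toReal with hw
  have hvol {x : ℕ × ℕ} (hx : x ∈ S) (hd : ¬∃ t : ℝ, INcell N x.1 x.2 ⊆ {p | p.1 + p.2 = t}) :=
    (INcell_degenerate_or_volume hN (Finset.mem_product.1 hx).1
      (Finset.mem_product.1 hx).2).resolve_left hd
  have hlog4 : Real.log (4 * (N:ℝ)^2) = Real.log (2 * (N:ℝ)^2) + Real.log 2 := by
    rw [← Real.log_mul (by positivity) (by norm_num)]
    congr 1
    ring
  have hterm {γ : Measure (ℝ × ℝ)} (hp : diagPlus γ ≤ volume.restrict (Set.Icc (-1:ℝ) 1))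
      (x : ℕ × ℕ) (hx : x ∈ S) : (γ (INcell N x.1 x.2)).toReal *
        Real.log ((γ (INcell N x.1 x.2)).toReal / (volume (INcell N x.1 x.2)).toReal) =
      (γ (INcell N x.1 x.2)).toReal * Real.log (γ (INcell N x.1 x.2)).toReal +
        (γ (INcell N x.1 x.2)).toReal * w x := by
    by_cases hd : ∃ t : ℝ, INcell N x.1 x.2 ⊆ {p | p.1 + p.2 = t}
    · simp [measure_INcell_eq_zero_of_degenerate hp hd]
    · have hv := hvol hx hd
      have hv0 : 0 < (volume (INcell N x.1 x.2)).toReal := lt_of_lt_of_le (by positivity) hv.1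
      simp only [hw, if_neg hd]
      rcases eq_or_ne (γ (INcell N x.1 x.2)).toReal 0 with h0 | h0
      · simp [h0]
      · rw [Real.log_div h0 hv0.ne']; ring
  have hwc (x : ℕ × ℕ) (hx : x ∈ S) : |w x - c| ≤ Real.log 2 / 2 := by
    have hl2 := Real.log_nonneg (one_le_two : (1:ℝ) ≤ 2)
    by_cases hd : ∃ t : ℝ, INcell N x.1 x.2 ⊆ {p | p.1 + p.2 = t}
    · simp only [hw, if_pos hd, sub_self, abs_zero]
      linarith
    · have hv := hvol hx hd
      have hv0 : 0 < (volume (INcell N x.1 x.2)).toReal := lt_of_lt_of_le (by positivity) hv.1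
      have l1 := Real.log_le_log (by positivity) hv.1
      have l2 := Real.log_le_log hv0 hv.2
      rw [one_div, Real.log_inv] at l1 l2
      simp only [hw, if_neg hd]
      rw [abs_le]
      constructor <;> linarith
  have hmem {γ : Measure (ℝ × ℝ)} [IsProbabilityMeasure γ] (x : ℕ × ℕ) (_ : x ∈ S) :
      0 ≤ (γ (INcell N x.1 x.2)).toReal ∧ (γ (INcell N x.1 x.2)).toReal ≤ 1 :=
    ⟨ENNReal.toReal_nonneg, measureReal_le_one⟩
  rw [← Finset.sum_product', ← Finset.sum_product', Finset.sum_congr rfl (hterm hp₁),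
    Finset.sum_congr rfl (hterm hp₂)]
  refine (abs_sum_entropy_sub_le S hmem hmem ?_ ?_ hwc hε₀ hε).trans_eq ?_
  · intro x hx
    obtain ⟨hi, hj⟩ := Finset.mem_product.1 hx
    obtain ⟨a1, b1⟩ := JNcell_endpoints hN hi
    obtain ⟨a2, b2⟩ := JNcell_endpoints hN hj
    exact (abs_sub_measure_Rset_le_qdist a1 b1 a2 b2).trans h
  · rw [hSdef, Finset.sum_product, Finset.sum_product, sum_measure_INcell hS₁ hp₁ hm₁ hN,
      sum_measure_INcell hS₂ hp₂ hm₂ hN]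
  · congr 1
    simp only [hSdef, Finset.card_product, Nat.card_Icc]
    push_cast
    ring

/-- **Claim (continuity bound for `H_q^N`).**
If `d(γ₁,γ₂) < ε` for queenons `γ₁, γ₂` and `0 < ε < 1/e`, then
`|H_q^N(γ₁) − H_q^N(γ₂)| ≤ 8N²ε log(N/(2ε²))`. -/
theorem HqN_continuity_bound (N : ℕ) (ε : ℝ) (hε₀ : 0 < ε) (hε₁ : ε < 1/Real.exp 1)
    (γ₁ γ₂ : ProbabilityMeasure (ℝ × ℝ)) (hγ₁ : γ₁ ∈ queenons) (hγ₂ : γ₂ ∈ queenons)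
    (h : qdist γ₁.toMeasure γ₂.toMeasure < ε) :
    |HqN N γ₁.toMeasure - HqN N γ₂.toMeasure| ≤
      8*(N:ℝ)^2*ε * Real.log ((N:ℝ)/(2*ε^2)) := by
  rcases Nat.eq_zero_or_pos N with rfl | hN
  · simp [HqN]
  have hN1 : (1:ℝ) ≤ N := by exact_mod_cast hN
  have hε : Real.log ε ≤ -1 := by
    rw [one_div, ← Real.exp_neg] at hε₁
    exact (Real.log_le_iff_le_exp hε₀).2 hε₁.le
  have hS₁ := queenons_unitSq_compl hγ₁
  have hS₂ := queenons_unitSq_compl hγ₂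
  have hm1 : (-1:ℝ) ∈ Set.Icc (-1:ℝ) 1 := by norm_num
  have h1 : (1:ℝ) ∈ Set.Icc (-1:ℝ) 1 := by norm_num
  have : IsProbabilityMeasure (diagPlus γ₁.toMeasure) :=
    Measure.isProbabilityMeasure_map (by fun_prop)
  have : IsProbabilityMeasure (diagPlus γ₂.toMeasure) :=
    Measure.isProbabilityMeasure_map (by fun_prop)
  have : IsProbabilityMeasure (diagMinus γ₁.toMeasure) :=
    Measure.isProbabilityMeasure_map (by fun_prop)
  have : IsProbabilityMeasure (diagMinus γ₂.toMeasure) :=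
    Measure.isProbabilityMeasure_map (by fun_prop)
  have hcells := abs_sum_cell_entropy_sub_le hS₁ hS₂ (diagPlus_le hγ₁) (diagPlus_le hγ₂)
    (diagMinus_le hγ₁) (diagMinus_le hγ₂) hN h.le hε₀ hε
  have hplus := abs_sum_bar_entropy_sub_le (diagPlus_le hγ₁) (diagPlus_le hγ₂) hN
    (diag_Icc_neg_one_one hS₁).1 (diag_Icc_neg_one_one hS₂).1 (fun i hi => by
      rw [JNcell, (diag_Icc_eq_measure_Rset hS₁ _ _).1, (diag_Icc_eq_measure_Rset hS₂ _ _).1]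
      exact (abs_sub_measure_Rset_le_qdist (JNcell_endpoints hN hi).1
        (JNcell_endpoints hN hi).2 hm1 h1).trans h.le) hε₀ hε
  have hminus := abs_sum_bar_entropy_sub_le (diagMinus_le hγ₁) (diagMinus_le hγ₂) hN
    (diag_Icc_neg_one_one hS₁).2 (diag_Icc_neg_one_one hS₂).2 (fun i hi => by
      rw [JNcell, (diag_Icc_eq_measure_Rset hS₁ _ _).2, (diag_Icc_eq_measure_Rset hS₂ _ _).2]
      exact (abs_sub_measure_Rset_le_qdist hm1 h1 (JNcell_endpoints hN hi).1
        (JNcell_endpoints hN hi).2).trans h.le) hε₀ hε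
  have hnum : 4 * (N:ℝ)^2 * (ε * (-Real.log ε + Real.log 2 / 2)) +
      2 * (2 * N * (ε * -Real.log ε)) ≤ 8*(N:ℝ)^2*ε * Real.log ((N:ℝ)/(2*ε^2)) := by
    have hlog : Real.log ((N:ℝ)/(2*ε^2)) = Real.log N - Real.log 2 - 2 * Real.log ε := by
      rw [Real.log_div (by positivity) (by positivity),
        Real.log_mul (by norm_num) (by positivity), Real.log_pow]
      push_cast
      ring
    have hNlog : 0 ≤ Real.log N := Real.log_nonneg hN1
    have hlog2 := Real.log_two_lt_d9
    have hNsq : (N:ℝ) ≤ (N:ℝ)^2 := by nlinarith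
    have e1 : 2 * (2 * N * (ε * -Real.log ε)) ≤ 4 * (N:ℝ)^2 * (ε * -Real.log ε) := by
      have := mul_le_mul_of_nonneg_right hNsq (mul_nonneg hε₀.le (by linarith : 0 ≤ -Real.log ε))
      linarith
    have e2 : 0 ≤ (N:ℝ)^2 * ε * (8 * Real.log N - 10 * Real.log 2 - 8 * Real.log ε) :=
      mul_nonneg (by positivity) (by linarith)
    rw [hlog]
    linarith
  unfold HqN barPlus barMinus
  rw [abs_le] at hcells hplus hminus ⊢
  constructor <;> linarith [hcells.1, hcells.2, hplus.1, hplus.2, hminus.1, hminus.2]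

end
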